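/- For any positive integer n and any even positive integer m, the number of conjugacy classes of the special orthogonal group SO(2n) consisting of elements x with x^m = 1 equals C(n + m/2, m/2) + C(n + m/2 - 2, n). -/

import Mathlib

open Matrix

/-- The special orthogonal group, as the subgroup of the orthogonal group
`Matrix.orthogonalGroup (Fin k) ℝ` consisting of the elements of determinant `1`. -/
noncomputable def SO (k : ℕ) : Subgroup (Matrix.orthogonalGroup (Fin k) ℝ) where
  carrier := {x | (x : Matrix (Fin k) (Fin k) ℝ).det = 1}
  one_mem' := by simp
  mul_mem' := by
    intro a b ha hb
    simp only [Set.mem_setOf_eq, Matrix.UnitaryGroup.mul_val, Matrix.det_mul] at *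
    rw [ha, hb, mul_one]
  inv_mem' := by
    intro a ha
    simp only [Set.mem_setOf_eq, Matrix.UnitaryGroup.inv_val, Matrix.star_eq_conjTranspose,
      Matrix.det_conjTranspose, star_trivial] at *
    exact ha

/-- A linear isometry of a Euclidean space either is diagonal with pairwise distinct eigenvalues
`±1` in some orthonormal basis, or acts as a rotation on some orthonormal pair. -/
theorem exists_orthonormal_rotation_pair {E : Type*} [NormedAddCommGroup E] [InnerProductSpace ℝ E]
    [FiniteDimensional ℝ E] (f : E →ₗ[ℝ] E) (hf : ∀ x y, inner ℝ (f x) (f y) = inner ℝ x y)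
    {d : ℕ} (hd : Module.finrank ℝ E = d) :
    (∃ (ε : Fin d → ℝ) (e : Fin d → E), Orthonormal ℝ e ∧ Function.Injective ε ∧
      (∀ j, ε j = 1 ∨ ε j = -1) ∧ ∀ j, f (e j) = ε j • e j) ∨
    ∃ (u w : E) (z : ℂ), ‖u‖ = 1 ∧ ‖w‖ = 1 ∧ inner ℝ u w = 0 ∧ ‖z‖ = 1 ∧ 0 ≤ z.im ∧
      f u = z.re • u + z.im • w ∧ f w = -z.im • u + z.re • w := by
  have hadj : ∀ x, f.adjoint (f x) = x := fun x =>
    ext_inner_right ℝ fun y => by rw [LinearMap.adjoint_inner_left, hf]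
  have hadj' : ∀ x, f (f.adjoint x) = x := by
    have h : f.adjoint * f = 1 := LinearMap.ext hadj
    exact fun x => LinearMap.congr_fun (mul_eq_one_comm.1 h) x
  have hsymm : (f + f.adjoint).IsSymmetric := by
    intro x y
    simp only [LinearMap.add_apply, inner_add_left, inner_add_right, LinearMap.adjoint_inner_left,
      LinearMap.adjoint_inner_right]
    ring
  let b := hsymm.eigenvectorBasis hd
  have hb := hsymm.apply_eigenvectorBasis hd
  have hnorm : ∀ x, ‖f x‖ = ‖x‖ := fun x => by
    rw [← sq_eq_sq₀ (norm_nonneg _) (norm_nonneg _), ← real_inner_self_eq_norm_sq, hf,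
      real_inner_self_eq_norm_sq]
  by_cases h : ∀ i, ∃ ε : ℝ, (ε = 1 ∨ ε = -1) ∧ f (b i) = ε • b i
  · choose ε hε hfε using h
    by_cases hinj : Function.Injective ε
    · exact .inl ⟨ε, b, b.orthonormal, hinj, hε, hfε⟩
    · obtain ⟨i, j, hij, hne⟩ : ∃ i j, ε i = ε j ∧ i ≠ j := by
        simpa [Function.Injective] using hinj
      refine .inr ⟨b i, b j, (ε i : ℂ), b.norm_eq_one i, b.norm_eq_one j,
        b.inner_eq_zero hne, ?_, by simp, by simp [hfε], by simp [hfε, hij]⟩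
      rcases hε i with h | h <;> simp [h]
  · push Not at h
    obtain ⟨i, hi⟩ := h
    obtain ⟨v, hv⟩ : ∃ v, b i = v := ⟨_, rfl⟩
    have hv1 : ‖v‖ = 1 := hv ▸ b.norm_eq_one i
    have hvv : inner ℝ v v = 1 := by rw [real_inner_self_eq_norm_sq, hv1, one_pow]
    obtain ⟨μ, hμ⟩ : ∃ μ : ℝ, f v + f.adjoint v = μ • v := by
      refine ⟨hsymm.eigenvalues hd i, ?_⟩
      rw [← hv]
      exact hb i
    rw [hv] at hi
    set c : ℝ := inner ℝ v (f v) with hc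
    have hμc : μ = 2 * c := by
      have := congrArg (inner ℝ v) hμ
      rw [inner_add_right, inner_smul_right, hvv, LinearMap.adjoint_inner_right,
        real_inner_comm] at this
      rw [real_inner_comm] at hc
      linarith
    have hff : f (f v) = (2 * c) • f v - v := by
      have := congrArg f hμ
      rw [map_add, hadj', map_smul, hμc] at this
      exact eq_sub_of_add_eq this
    obtain ⟨r, hr⟩ : ∃ r, f v = c • v + r := ⟨f v - c • v, by abel⟩
    have hvr : inner ℝ v r = 0 := by
      have := hc
      rw [hr, inner_add_right, inner_smul_right, hvv] at this
      linarith
    have hcr : c ^ 2 + ‖r‖ ^ 2 = 1 := by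
      have h1 : inner ℝ (f v) (f v) = (1 : ℝ) := by rw [hf, hvv]
      rw [hr, inner_add_left, inner_add_right, inner_add_right, inner_smul_left, inner_smul_right,
        inner_smul_left, inner_smul_right, real_inner_comm v r, hvr, hvv,
        real_inner_self_eq_norm_sq] at h1
      simp at h1
      linarith
    have hr0 : r ≠ 0 := by
      rintro rfl
      refine hi c ?_ (by simpa using hr)
      simpa using hcr
    have hs : ‖r‖ ≠ 0 := norm_ne_zero_iff.2 hr0
    have hfr : f r = (-‖r‖ ^ 2) • v + c • r := by
      have : f r = f (f v) - c • f v := by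
        conv_rhs => enter [1, 2]; rw [hr]
        simp
      rw [this, hff, hr, show -‖r‖ ^ 2 = c ^ 2 - 1 by linarith]
      module
    refine .inr ⟨v, ‖r‖⁻¹ • r, ⟨c, ‖r‖⟩, hv1, ?_, ?_, ?_, norm_nonneg r, ?_, ?_⟩
    · rw [norm_smul, norm_inv, norm_norm, inv_mul_cancel₀ hs]
    · rw [inner_smul_right, hvr, mul_zero]
    · rw [← sq_eq_sq₀ (norm_nonneg _) zero_le_one, ← Complex.normSq_eq_norm_sq, Complex.normSq_mk]
      linarith
    · rw [smul_smul, mul_inv_cancel₀ hs, one_smul, hr]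
    · rw [map_smul, hfr, smul_add, smul_smul, smul_comm c]
      congr 2
      simp only
      field_simp

/-- Real normal form of a linear isometry: rotations on orthonormal pairs, together with an
orthonormal family of eigenvectors with pairwise distinct eigenvalues `±1`. -/
theorem exists_orthonormal_rotation_normal_form (d : ℕ) : ∀ (E : Type) [NormedAddCommGroup E]
    [InnerProductSpace ℝ E] [FiniteDimensional ℝ E] (f : E →ₗ[ℝ] E),
    (∀ x y, inner ℝ (f x) (f y) = inner ℝ x y) → Module.finrank ℝ E = d →
    ∃ (k l : ℕ) (z : Fin k → ℂ) (ε : Fin l → ℝ) (u w : Fin k → E) (e : Fin l → E),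
      Orthonormal ℝ (Sum.elim (Sum.elim u w) e) ∧ k + k + l = d ∧
      (∀ i, ‖z i‖ = 1 ∧ 0 ≤ (z i).im) ∧ Function.Injective ε ∧ (∀ j, ε j = 1 ∨ ε j = -1) ∧
      (∀ i, f (u i) = (z i).re • u i + (z i).im • w i) ∧
      (∀ i, f (w i) = -(z i).im • u i + (z i).re • w i) ∧ ∀ j, f (e j) = ε j • e j := by
  induction d using Nat.strong_induction_on with
  | _ d ih =>
  intro E _ _ _ f hf hd
  rcases exists_orthonormal_rotation_pair f hf hd with
    ⟨ε, e, he, hinj, hε, hfe⟩ | ⟨u, w, z, hu, hw, huw, hz, hz0, hfu, hfw⟩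
  · refine ⟨0, d, Fin.elim0, ε, Fin.elim0, Fin.elim0, e, ?_, by simp, fun i => i.elim0, hinj, hε,
      fun i => i.elim0, fun i => i.elim0, hfe⟩
    rw [orthonormal_iff_ite] at he ⊢
    rintro ((i | i) | i) ((j | j) | j)
    all_goals first | exact i.elim0 | exact j.elim0 | simp [he]
  · let W : Submodule ℝ E := Submodule.span ℝ (Set.range ![u, w])
    have hon : Orthonormal ℝ ![u, w] := by
      rw [orthonormal_iff_ite]
      intro i j
      fin_cases i <;> fin_cases j <;>
        simp [hu, hw, huw, real_inner_comm u w]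
    have hW : Module.finrank ℝ W = 2 := by
      rw [finrank_span_eq_card hon.linearIndependent, Fintype.card_fin]
    have hsum := W.finrank_add_finrank_orthogonal
    rw [hW, hd] at hsum
    have hmem : ∀ x, x ∈ Wᗮ ↔ inner ℝ u x = 0 ∧ inner ℝ w x = 0 := by
      intro x
      rw [Submodule.mem_orthogonal]
      constructor
      · exact fun h => ⟨h _ (Submodule.subset_span ⟨0, rfl⟩), h _ (Submodule.subset_span ⟨1, rfl⟩)⟩
      · rintro ⟨h1, h2⟩ y hy
        induction hy using Submodule.span_induction with
        | mem y hy => obtain ⟨i, rfl⟩ := hy; fin_cases i <;> simp [h1, h2]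
        | zero => simp
        | add a b _ _ ha hb => rw [inner_add_left, ha, hb, add_zero]
        | smul a b _ hb => rw [inner_smul_left, hb, mul_zero]
    have hcs : z.re ^ 2 + z.im ^ 2 = 1 := by
      have := Complex.normSq_eq_norm_sq z
      rw [hz, Complex.normSq_apply] at this
      linarith
    have hinv : ∀ x ∈ Wᗮ, f x ∈ Wᗮ := by
      intro x hx
      rw [hmem] at hx ⊢
      have h1 := hf u x
      have h2 := hf w x
      rw [hfu, inner_add_left, real_inner_smul_left, real_inner_smul_left, hx.1] at h1
      rw [hfw, inner_add_left, real_inner_smul_left, real_inner_smul_left, hx.2] at h2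
      constructor
      · linear_combination z.re * h1 - z.im * h2 - inner ℝ u (f x) * hcs
      · linear_combination z.im * h1 + z.re * h2 - inner ℝ w (f x) * hcs
    obtain ⟨k, l, z', ε, u', w', e, hon', hkl, hz', hinj, hε, hfu', hfw', hfe⟩ :=
      ih (Module.finrank ℝ Wᗮ) (by omega) Wᗮ (f.restrict hinv) (fun x y => hf x y) rfl
    refine ⟨k + 1, l, Fin.cons z z', ε, Fin.cons u fun i => u' i, Fin.cons w fun i => w' i,
      fun j => e j, ?_, by omega, ?_, hinj, hε, ?_, ?_, ?_⟩
    · have hWu : ∀ x : Wᗮ, inner ℝ u (x : E) = 0 := fun x => ((hmem x).1 x.2).1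
      have hWw : ∀ x : Wᗮ, inner ℝ w (x : E) = 0 := fun x => ((hmem x).1 x.2).2
      have hWu' : ∀ x : Wᗮ, inner ℝ (x : E) u = 0 := fun x => by rw [real_inner_comm, hWu]
      have hWw' : ∀ x : Wᗮ, inner ℝ (x : E) w = 0 := fun x => by rw [real_inner_comm, hWw]
      rw [orthonormal_iff_ite] at hon' ⊢
      have huu := fun i j => hon' (.inl (.inl i)) (.inl (.inl j))
      have huw' := fun i j => hon' (.inl (.inl i)) (.inl (.inr j))
      have hue := fun i j => hon' (.inl (.inl i)) (.inr j)
      have hwu := fun i j => hon' (.inl (.inr i)) (.inl (.inl j))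
      have hww := fun i j => hon' (.inl (.inr i)) (.inl (.inr j))
      have hwe := fun i j => hon' (.inl (.inr i)) (.inr j)
      have heu := fun i j => hon' (.inr i) (.inl (.inl j))
      have hew := fun i j => hon' (.inr i) (.inl (.inr j))
      have hee := fun i j => hon' (.inr i) (.inr j)
      simp only [Sum.elim_inl, Sum.elim_inr, Submodule.coe_inner]
        at huu huw' hue hwu hww hwe heu hew hee
      rintro ((i | i) | i) ((j | j) | j) <;>
      (try refine Fin.cases ?_ (fun i => ?_) i) <;> (try refine Fin.cases ?_ (fun j => ?_) j) <;>
      simp [hu, hw, huw, real_inner_comm u w, hWu, hWw, hWu', hWw',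
        huu, huw', hue, hwu, hww, hwe, heu, hew, hee, Fin.succ_ne_zero, (Fin.succ_ne_zero _).symm]
    · exact Fin.cases ⟨hz, hz0⟩ hz'
    · refine Fin.cases hfu fun i => ?_
      simpa using congrArg Subtype.val (hfu' i)
    · refine Fin.cases hfw fun i => ?_
      simpa using congrArg Subtype.val (hfw' i)
    · intro j
      simpa using congrArg Subtype.val (hfe j)

section

variable {κ : Type*} [DecidableEq κ]

/-- The real matrix with `2 × 2` rotation-scaling blocks given by the complex numbers `z i`. -/
noncomputable def rotBlocks (z : κ → ℂ) : Matrix (κ ⊕ κ) (κ ⊕ κ) ℝ :=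
  fromBlocks (diagonal fun i => (z i).re) (-diagonal fun i => (z i).im)
    (diagonal fun i => (z i).im) (diagonal fun i => (z i).re)

theorem rotBlocks_one : rotBlocks (1 : κ → ℂ) = 1 := by
  simp [rotBlocks, ← fromBlocks_one]

theorem rotBlocks_injective : Function.Injective (rotBlocks : (κ → ℂ) → _) := by
  intro z w h
  obtain ⟨h1, -, h2, -⟩ := fromBlocks_inj.1 h
  ext i
  exact Complex.ext (congrFun (diagonal_injective h1) i) (congrFun (diagonal_injective h2) i)

theorem rotBlocks_transpose (z : κ → ℂ) : (rotBlocks z)ᵀ = rotBlocks (star z) := by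
  simp [rotBlocks, fromBlocks_transpose]

theorem rotBlocks_comp (z : κ → ℂ) (σ : Equiv.Perm κ) :
    rotBlocks (z ∘ σ) = (rotBlocks z).submatrix (σ.sumCongr σ) (σ.sumCongr σ) := by
  ext (a | a) (b | b) <;> simp [rotBlocks, diagonal_apply]

/-- The diagonal reflection negating the first coordinate of the `i`-th block. -/
noncomputable def blockReflection (i : κ) : Matrix (κ ⊕ κ) (κ ⊕ κ) ℝ :=
  diagonal (Sum.elim (Function.update 1 i (-1)) 1)

theorem blockReflection_transpose (i : κ) : (blockReflection i)ᵀ = blockReflection i :=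
  diagonal_transpose _

variable [Fintype κ]

theorem rotBlocks_mul (z w : κ → ℂ) : rotBlocks (z * w) = rotBlocks z * rotBlocks w := by
  simp only [rotBlocks, fromBlocks_multiply, diagonal_mul_diagonal,
    diagonal_add, diagonal_neg, Pi.mul_apply, Complex.mul_re, Complex.mul_im]
  congr 2 <;> (try ext i) <;> (try simp) <;> ring

theorem rotBlocks_pow (z : κ → ℂ) (m : ℕ) : rotBlocks z ^ m = rotBlocks (z ^ m) := by
  induction m with
  | zero => simp [rotBlocks_one]
  | succ m ih => rw [pow_succ, pow_succ, rotBlocks_mul, ih]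

theorem rotBlocks_mul_transpose {z : κ → ℂ} (hz : ∀ i, ‖z i‖ = 1) :
    rotBlocks z * (rotBlocks z)ᵀ = 1 := by
  rw [rotBlocks_transpose, ← rotBlocks_mul, ← rotBlocks_one]
  congr 1
  ext i
  simp [Complex.mul_conj, Complex.normSq_eq_norm_sq, hz]

theorem det_fromBlocks_nonneg (P Q : Matrix κ κ ℝ) : 0 ≤ (fromBlocks P (-Q) Q P).det := by
  let f := algebraMap ℝ ℂ
  have key : (fromBlocks 1 (Complex.I • 1) 0 1 : Matrix (κ ⊕ κ) (κ ⊕ κ) ℂ) *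
      (fromBlocks P (-Q) Q P).map f * fromBlocks 1 (-(Complex.I • 1)) 0 1 =
      fromBlocks (P.map f + Complex.I • Q.map f) 0 (Q.map f) (P.map f - Complex.I • Q.map f) := by
    simp only [fromBlocks_map, fromBlocks_multiply]
    congr 1
    · simp
    · ext i j
      simp only [Matrix.mul_neg, Matrix.mul_smul, Matrix.smul_mul, Matrix.one_mul, Matrix.mul_one,
        Matrix.add_apply, Matrix.neg_apply, Matrix.smul_apply, Matrix.map_apply, smul_eq_mul,
        map_neg, Matrix.zero_apply]
      linear_combination (-f (Q i j)) * Complex.I_mul_I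
    · simp
    · simp [sub_eq_neg_add]
  have hconj : (P.map f - Complex.I • Q.map f) =
      (starRingEnd ℂ).mapMatrix (P.map f + Complex.I • Q.map f) := by
    ext i j
    simp [f, sub_eq_add_neg]
  have hdet := congrArg det key
  rw [det_mul, det_mul, det_fromBlocks_zero₂₁, det_fromBlocks_zero₂₁, det_fromBlocks_zero₁₂, hconj,
    ← RingHom.map_det, Complex.mul_conj] at hdet
  simp only [det_one, one_mul, mul_one] at hdet
  rw [← RingHom.mapMatrix_apply, ← RingHom.map_det] at hdet
  have hreal : (fromBlocks P (-Q) Q P).det =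
      Complex.normSq (P.map f + Complex.I • Q.map f).det := Complex.ofReal_injective hdet
  rw [hreal]
  exact Complex.normSq_nonneg _

theorem det_rotBlocks {z : κ → ℂ} (hz : ∀ i, ‖z i‖ = 1) : (rotBlocks z).det = 1 := by
  have h := congrArg det (rotBlocks_mul_transpose hz)
  rw [det_mul, det_transpose, det_one] at h
  have := det_fromBlocks_nonneg (diagonal fun i => (z i).re) (diagonal fun i => (z i).im)
  change 0 ≤ (rotBlocks z).det at this
  nlinarith

theorem mul_transpose_of_mul_eq {ι : Type*} [Fintype ι] [DecidableEq ι] {g a b : Matrix ι ι ℝ}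
    (hg : g * gᵀ = 1) (h : g * a = b * g) : g * aᵀ = bᵀ * g := by
  have hg' : gᵀ * g = 1 := mul_eq_one_comm.1 hg
  have h' := congrArg transpose h
  rw [transpose_mul, transpose_mul] at h'
  calc g * aᵀ = g * (aᵀ * gᵀ) * g := by
        rw [Matrix.mul_assoc, Matrix.mul_assoc, hg', Matrix.mul_one]
    _ = bᵀ * g := by rw [h', ← Matrix.mul_assoc, hg, Matrix.one_mul]

/-- An orthogonal matrix intertwining `rotBlocks z` and `rotBlocks w` has determinant one when all
`z i` and `w i` lie in the open upper half plane. -/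
theorem det_eq_one_of_mul_rotBlocks {z w : κ → ℂ} (hz : ∀ i, 0 < (z i).im)
    (hw : ∀ i, 0 < (w i).im) {g : Matrix (κ ⊕ κ) (κ ⊕ κ) ℝ} (hg : g * gᵀ = 1)
    (h : g * rotBlocks z = rotBlocks w * g) : g.det = 1 := by
  have hT := mul_transpose_of_mul_eq hg h
  have hA : g * (rotBlocks z - (rotBlocks z)ᵀ) = (rotBlocks w - (rotBlocks w)ᵀ) * g := by
    rw [mul_sub, sub_mul, h, hT]
  have hent := fun i j => congrFun (congrFun hA i) j
  obtain ⟨P, Q', Q, R, rfl⟩ : ∃ P Q' Q R, g = fromBlocks P Q' Q R :=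
    ⟨_, _, _, _, (fromBlocks_toBlocks g).symm⟩
  have h11 := fun i j => hent (.inl i) (.inl j)
  have h12 := fun i j => hent (.inl i) (.inr j)
  have h21 := fun i j => hent (.inr i) (.inl j)
  have h22 := fun i j => hent (.inr i) (.inr j)
  have hsub : ∀ z : κ → ℂ, rotBlocks z - (rotBlocks z)ᵀ =
      fromBlocks 0 (-diagonal fun i => 2 * (z i).im) (diagonal fun i => 2 * (z i).im) 0 := by
    intro z
    rw [rotBlocks, fromBlocks_transpose, sub_eq_add_neg, fromBlocks_neg, fromBlocks_add]
    congr 1 <;> simp <;> intro i <;> ring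
  simp only [hsub, fromBlocks_multiply, fromBlocks_apply₁₁, fromBlocks_apply₁₂, fromBlocks_apply₂₁,
    fromBlocks_apply₂₂, Matrix.mul_zero, Matrix.zero_mul, zero_add, add_zero, Matrix.mul_neg,
    Matrix.neg_mul, Matrix.neg_apply, mul_diagonal, diagonal_mul] at h11 h12 h21 h22
  have aux : ∀ a b p q : ℝ, 0 < a → 0 < b → p * b = a * q → q * b = a * p → p = q := by
    intro a b p q ha hb h1 h2
    have : (p - q) * (a + b) = 0 := by linear_combination h1 - h2
    rcases mul_eq_zero.1 this with h | h <;> linarith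
  have hR : R = P := by
    ext i j
    refine (aux _ _ _ _ (hw i) (hz j) ?_ ?_).symm
    · linarith [h12 i j]
    · linarith [h21 i j]
  have hQ : Q' = -Q := by
    ext i j
    refine (aux _ _ _ _ (hw i) (hz j) ?_ ?_)
    · simp only [Matrix.neg_apply]; linarith [h11 i j]
    · simp only [Matrix.neg_apply]; linarith [h22 i j]
  subst hR hQ
  have h1 := congrArg det hg
  rw [det_mul, det_transpose, det_one] at h1
  have := det_fromBlocks_nonneg R Q
  nlinarith

theorem map_re_eq_of_mul_rotBlocks {z w : κ → ℂ} {g : Matrix (κ ⊕ κ) (κ ⊕ κ) ℝ}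
    (hg : g * gᵀ = 1) (h : g * rotBlocks z = rotBlocks w * g) :
    Finset.univ.val.map (fun i => (z i).re) = Finset.univ.val.map fun i => (w i).re := by
  have hadd : ∀ z : κ → ℂ, rotBlocks z + (rotBlocks z)ᵀ =
      diagonal (Sum.elim (fun i => 2 * (z i).re) fun i => 2 * (z i).re) := by
    intro z
    rw [rotBlocks, fromBlocks_transpose, fromBlocks_add, ← fromBlocks_diagonal]
    congr 1 <;> simp <;> intro i <;> ring
  have hA : g * (rotBlocks z + (rotBlocks z)ᵀ) = (rotBlocks w + (rotBlocks w)ᵀ) * g := by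
    rw [mul_add, add_mul, h, mul_transpose_of_mul_eq hg h]
  let G : (Matrix (κ ⊕ κ) (κ ⊕ κ) ℝ)ˣ := ⟨g, gᵀ, hg, mul_eq_one_comm.1 hg⟩
  have hchar : (rotBlocks z + (rotBlocks z)ᵀ).charpoly =
      (rotBlocks w + (rotBlocks w)ᵀ).charpoly := by
    rw [← charpoly_units_conj G,
      show (G : Matrix (κ ⊕ κ) (κ ⊕ κ) ℝ)⁻¹ = gᵀ from inv_eq_right_inv hg]
    congr 1
    change g * _ * gᵀ = _
    rw [hA, Matrix.mul_assoc, hg, Matrix.mul_one]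
  have hroots : ∀ z : κ → ℂ, (rotBlocks z + (rotBlocks z)ᵀ).charpoly.roots =
      2 • Finset.univ.val.map fun i => 2 * (z i).re := by
    intro z
    rw [hadd, charpoly_diagonal, Fintype.prod_sum_type]
    simp only [Sum.elim_inl, Sum.elim_inr]
    rw [← sq, Polynomial.roots_pow]
    congr 1
    rw [← Polynomial.roots_multiset_prod_X_sub_C (Finset.univ.val.map fun i => 2 * (z i).re),
      Multiset.map_map]
    rfl
  have heq := congrArg Polynomial.roots hchar
  rw [hroots, hroots] at heq
  have heq' := nsmul_right_injective two_ne_zero heq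
  simpa using congrArg (Multiset.map fun x : ℝ => x / 2) heq'

theorem map_eq_of_mul_rotBlocks {z w : κ → ℂ} (hz : ∀ i, ‖z i‖ = 1 ∧ 0 ≤ (z i).im)
    (hw : ∀ i, ‖w i‖ = 1 ∧ 0 ≤ (w i).im) {g : Matrix (κ ⊕ κ) (κ ⊕ κ) ℝ}
    (hg : g * gᵀ = 1) (h : g * rotBlocks z = rotBlocks w * g) :
    Finset.univ.val.map z = Finset.univ.val.map w := by
  have key : ∀ x : ℂ, ‖x‖ = 1 ∧ 0 ≤ x.im → (⟨x.re, √(1 - x.re ^ 2)⟩ : ℂ) = x := by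
    rintro x ⟨hx, hx0⟩
    refine Complex.ext rfl ?_
    have := Complex.normSq_eq_norm_sq x
    rw [hx, Complex.normSq_apply] at this
    change √(1 - x.re ^ 2) = x.im
    rw [show 1 - x.re ^ 2 = x.im ^ 2 by linarith, Real.sqrt_sq hx0]
  have := congrArg (Multiset.map fun x : ℝ => (⟨x, √(1 - x ^ 2)⟩ : ℂ))
    (map_re_eq_of_mul_rotBlocks hg h)
  simpa [Function.comp_def, key _ (hz _), key _ (hw _)] using this

theorem blockReflection_mul_self (i : κ) : blockReflection i * blockReflection i = 1 := by
  rw [blockReflection, diagonal_mul_diagonal, ← diagonal_one]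
  congr 1
  ext (j | j)
  · by_cases h : j = i
    · subst h; simp
    · simp [h]
  · simp

theorem det_blockReflection (i : κ) : (blockReflection i).det = -1 := by
  rw [blockReflection, det_diagonal, Fintype.prod_sum_type]
  simp [Finset.prod_update_of_mem]

theorem blockReflection_mul_rotBlocks {z : κ → ℂ} {i : κ} (hi : (z i).im = 0) :
    blockReflection i * rotBlocks z = rotBlocks z * blockReflection i := by
  rw [blockReflection, rotBlocks]
  ext (a | a) (b | b)
  all_goals
    simp only [diagonal_mul, mul_diagonal, Sum.elim_inl, Sum.elim_inr, fromBlocks_apply₁₁,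
      fromBlocks_apply₁₂, fromBlocks_apply₂₁, fromBlocks_apply₂₂, diagonal_apply]
    by_cases hab : a = b
    · subst hab
      by_cases h : a = i
      · subst h; simp [hi]
      · simp [h]
    · simp [hab]

/-- Every matrix in `SO(2n)` is orthogonally conjugate to a matrix of rotation blocks. -/
theorem exists_mul_eq_mul_rotBlocks {n : ℕ} {X : Matrix (Fin n ⊕ Fin n) (Fin n ⊕ Fin n) ℝ}
    (hX : X * Xᵀ = 1) (hdet : X.det = 1) :
    ∃ (z : Fin n → ℂ) (g : Matrix (Fin n ⊕ Fin n) (Fin n ⊕ Fin n) ℝ),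
      (∀ i, ‖z i‖ = 1 ∧ 0 ≤ (z i).im) ∧ g * gᵀ = 1 ∧ X * g = g * rotBlocks z := by
  have hX' : Xᵀ * X = 1 := mul_eq_one_comm.1 hX
  have hiso : ∀ x y, inner ℝ (toEuclideanLin X x) (toEuclideanLin X y) = inner ℝ x y := by
    intro x y
    rw [EuclideanSpace.inner_eq_star_dotProduct, EuclideanSpace.inner_eq_star_dotProduct]
    simp only [star_trivial, ofLp_toLpLin, toLin'_apply]
    rw [dotProduct_mulVec, vecMul_mulVec, hX', vecMul_one]
  obtain ⟨k, l, z, ε, u, w, e, hon, hkl, hz, hinj, hε, hu, hw, he⟩ :=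
    exists_orthonormal_rotation_normal_form (n + n) _ (toEuclideanLin X) hiso (by simp)
  let G : Matrix (Fin n ⊕ Fin n) ((Fin k ⊕ Fin k) ⊕ Fin l) ℝ :=
    of fun p q => Sum.elim (Sum.elim u w) e q p
  have hG : Gᵀ * G = 1 := by
    ext p q
    rw [orthonormal_iff_ite] at hon
    rw [one_apply, ← hon p q, EuclideanSpace.inner_eq_star_dotProduct, dotProduct_comm]
    rfl
  have hXG : X * G = G * fromBlocks (rotBlocks z) 0 0 (diagonal ε) := by
    have hcol : ∀ p q, (X * G) p q = toEuclideanLin X (Sum.elim (Sum.elim u w) e q) p :=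
      fun p q => rfl
    ext p q
    rw [hcol]
    rcases q with (q | q) | q
    · simp [hu, mul_apply, Fintype.sum_sum_type, rotBlocks, diagonal_apply, G, mul_comm]
    · simp [hw, mul_apply, Fintype.sum_sum_type, rotBlocks, diagonal_apply, G, mul_comm]
    · simp [he, mul_apply, Fintype.sum_sum_type, diagonal_apply, G, mul_comm]
  have hprod : ∏ j, ε j = 1 := by
    let τ : Fin n ⊕ Fin n ≃ (Fin k ⊕ Fin k) ⊕ Fin l := Fintype.equivOfCardEq (by simp [hkl])
    have h1 : (G.submatrix id τ)ᵀ * G.submatrix id τ = 1 := by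
      change (Gᵀ * G).submatrix τ τ = 1
      rw [hG, submatrix_one_equiv]
    have h2 : X * G.submatrix id τ = G.submatrix id τ *
        (fromBlocks (rotBlocks z) 0 0 (diagonal ε)).submatrix τ τ := by
      rw [submatrix_mul_equiv, ← hXG]
      rfl
    have h3 : (G.submatrix id τ).det ≠ 0 := by
      intro h
      have := congrArg det h1
      simp [det_mul, h] at this
    have h4 := congrArg det h2
    rw [det_mul, det_mul, hdet, det_submatrix_equiv_self, det_fromBlocks_zero₁₂, det_diagonal,
      det_rotBlocks fun i => (hz i).1, mul_comm] at h4
    simpa using (mul_left_cancel₀ h3 h4).symm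
  have hl : l ≤ 2 := by
    have : (Finset.univ.image ε).card ≤ ({1, -1} : Finset ℝ).card := by
      refine Finset.card_le_card fun x hx => ?_
      obtain ⟨j, -, rfl⟩ := Finset.mem_image.1 hx
      simpa using hε j
    rw [Finset.card_image_of_injective _ hinj, Finset.card_univ, Fintype.card_fin] at this
    exact this.trans Finset.card_le_two
  have hl0 : l = 0 := by
    interval_cases l
    · rfl
    · omega
    · have h01 : ε 0 ≠ ε 1 := fun h => by simpa using hinj h
      rw [Fin.prod_univ_two] at hprod
      rcases hε 0 with h0 | h0 <;> rcases hε 1 with h1 | h1 <;> rw [h0, h1] at hprod h01 <;>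
        first | exact absurd rfl h01 | norm_num at hprod
  subst hl0
  obtain rfl : k = n := by omega
  refine ⟨z, G.submatrix id Sum.inl, hz, mul_eq_one_comm.1 ?_, ?_⟩
  · ext p q
    have : (Gᵀ * G) (.inl p) (.inl q) = _ := congrFun (congrFun hG (.inl p)) (.inl q)
    exact this.trans (by simp [one_apply])
  · ext p q
    simpa [mul_apply, Fintype.sum_sum_type] using congrFun (congrFun hXG p) (.inl q)

theorem exists_perm_comp_eq {α β : Type*} [Fintype α] [DecidableEq β] {f g : α → β}
    (h : Finset.univ.val.map f = Finset.univ.val.map g) : ∃ σ : Equiv.Perm α, g ∘ σ = f := by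
  have hcard : ∀ b, Fintype.card {a // f a = b} = Fintype.card {a // g a = b} := by
    intro b
    have := congrArg (Multiset.count b) h
    rw [Multiset.count_map, Multiset.count_map] at this
    rw [Fintype.card_subtype, Fintype.card_subtype]
    simpa [Finset.card, eq_comm] using this
  refine ⟨Equiv.ofFiberEquiv fun b => Fintype.equivOfCardEq (hcard b), ?_⟩
  ext a
  exact Equiv.ofFiberEquiv_map _ a

end

section

variable {n : ℕ}

/-- The matrix of an element of `SO (2 * n)` with its index set split in two halves. -/
noncomputable def splitMatrix (n : ℕ) :
    SO (2 * n) →* Matrix (Fin n ⊕ Fin n) (Fin n ⊕ Fin n) ℝ :=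
  (reindexAlgEquiv ℝ ℝ (finSumFinEquiv.trans (finCongr (two_mul n).symm)).symm :
      Matrix (Fin (2 * n)) (Fin (2 * n)) ℝ →* _).comp
    ((orthogonalGroup (Fin (2 * n)) ℝ).subtype.comp (SO (2 * n)).subtype)

theorem splitMatrix_apply (x : SO (2 * n)) : splitMatrix n x =
    reindex (finSumFinEquiv.trans (finCongr (two_mul n).symm)).symm
      (finSumFinEquiv.trans (finCongr (two_mul n).symm)).symm
      ((x : orthogonalGroup (Fin (2 * n)) ℝ) : Matrix (Fin (2 * n)) (Fin (2 * n)) ℝ) := rfl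

theorem splitMatrix_injective : Function.Injective (splitMatrix n) := by
  intro x y h
  rw [splitMatrix_apply, splitMatrix_apply] at h
  exact Subtype.ext (Subtype.ext ((reindex _ _).injective h))

theorem splitMatrix_mul_transpose (x : SO (2 * n)) :
    splitMatrix n x * (splitMatrix n x)ᵀ = 1 := by
  have h := (mem_orthogonalGroup_iff (Fin (2 * n)) ℝ).1 x.1.2
  rw [splitMatrix_apply, reindex_apply, transpose_submatrix, submatrix_mul_equiv, h,
    submatrix_one_equiv]

theorem det_splitMatrix (x : SO (2 * n)) : (splitMatrix n x).det = 1 := by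
  rw [splitMatrix_apply, reindex_apply, det_submatrix_equiv_self]
  exact x.2

theorem exists_splitMatrix_eq {A : Matrix (Fin n ⊕ Fin n) (Fin n ⊕ Fin n) ℝ} (hA : A * Aᵀ = 1)
    (hdet : A.det = 1) : ∃ x, splitMatrix n x = A := by
  let e : Fin (2 * n) ≃ Fin n ⊕ Fin n := (finSumFinEquiv.trans (finCongr (two_mul n).symm)).symm
  have h : A.submatrix e e ∈ orthogonalGroup (Fin (2 * n)) ℝ := by
    rw [mem_orthogonalGroup_iff, transpose_submatrix, submatrix_mul_equiv, hA, submatrix_one_equiv]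
  refine ⟨⟨⟨A.submatrix e e, h⟩, (det_submatrix_equiv_self e A).trans hdet⟩, ?_⟩
  exact (reindex e e).apply_symm_apply A

theorem isConj_iff_splitMatrix {x y : SO (2 * n)} : IsConj x y ↔
    ∃ g, g * gᵀ = 1 ∧ g.det = 1 ∧ g * splitMatrix n x = splitMatrix n y * g := by
  rw [isConj_iff]
  constructor
  · rintro ⟨c, rfl⟩
    refine ⟨splitMatrix n c, splitMatrix_mul_transpose c, det_splitMatrix c, ?_⟩
    rw [← (splitMatrix n).map_mul, ← (splitMatrix n).map_mul, inv_mul_cancel_right]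
  · rintro ⟨g, hg, hdet, h⟩
    obtain ⟨c, rfl⟩ := exists_splitMatrix_eq hg hdet
    refine ⟨c, ?_⟩
    rw [mul_inv_eq_iff_eq_mul]
    apply splitMatrix_injective
    rw [(splitMatrix n).map_mul, (splitMatrix n).map_mul, h]

/-- The `m`-th roots of unity in the closed upper half plane. -/
noncomputable def upperRoots (m : ℕ) : Finset ℂ :=
  (Polynomial.nthRootsFinset m 1).filter fun z => 0 ≤ z.im

/-- The `m`-th roots of unity in the open upper half plane. -/
noncomputable def strictUpperRoots (m : ℕ) : Finset ℂ :=
  (Polynomial.nthRootsFinset m 1).filter fun z => 0 < z.im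

theorem mem_upperRoots {m : ℕ} (hm : 0 < m) {z : ℂ} :
    z ∈ upperRoots m ↔ z ^ m = 1 ∧ 0 ≤ z.im := by
  rw [upperRoots, Finset.mem_filter, Polynomial.mem_nthRootsFinset hm]

theorem mem_strictUpperRoots {m : ℕ} (hm : 0 < m) {z : ℂ} :
    z ∈ strictUpperRoots m ↔ z ^ m = 1 ∧ 0 < z.im := by
  rw [strictUpperRoots, Finset.mem_filter, Polynomial.mem_nthRootsFinset hm]

theorem norm_eq_one_of_mem_upperRoots {m : ℕ} (hm : 0 < m) {z : ℂ} (hz : z ∈ upperRoots m) :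
    ‖z‖ = 1 ∧ 0 ≤ z.im :=
  ⟨Complex.norm_eq_one_of_pow_eq_one ((mem_upperRoots hm).1 hz).1 hm.ne',
    ((mem_upperRoots hm).1 hz).2⟩

theorem strictUpperRoots_subset (m : ℕ) : strictUpperRoots m ⊆ upperRoots m :=
  Finset.monotone_filter_right _ fun _ _ h => le_of_lt h

theorem card_upperRoots {m : ℕ} (hm : 0 < m) (heven : Even m) :
    (upperRoots m).card = m / 2 + 1 ∧ (strictUpperRoots m).card = m / 2 - 1 := by
  have hreal : (Polynomial.nthRootsFinset m (1 : ℂ)).filter (fun z => z.im = 0) = {1, -1} := by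
    ext z
    rw [Finset.mem_filter, Polynomial.mem_nthRootsFinset hm, Finset.mem_insert,
      Finset.mem_singleton]
    constructor
    · rintro ⟨h, h0⟩
      have h1 := Complex.norm_eq_one_of_pow_eq_one h hm.ne'
      have h2 := Complex.normSq_eq_norm_sq z
      rw [Complex.normSq_apply, h0, h1] at h2
      have h3 : (z.re - 1) * (z.re + 1) = 0 := by linarith
      rcases mul_eq_zero.1 h3 with h3 | h3
      · exact .inl (Complex.ext (by simp; linarith) (by simpa using h0))
      · exact .inr (Complex.ext (by simp; linarith) (by simpa using h0))
    · rintro (rfl | rfl) <;> simp [heven.neg_one_pow]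
  have hconj : ((Polynomial.nthRootsFinset m (1 : ℂ)).filter fun z => z.im < 0).card =
      (strictUpperRoots m).card := by
    refine Finset.card_nbij' (starRingEnd ℂ) (starRingEnd ℂ) ?_ ?_ (by simp [Set.LeftInvOn])
      (by simp [Set.LeftInvOn])
    all_goals
      intro z hz
      simp only [strictUpperRoots, Finset.coe_filter, Polynomial.mem_nthRootsFinset hm,
        Set.mem_ofPred_eq, Complex.conj_im] at hz ⊢
      refine ⟨by rw [← map_pow, hz.1, map_one], by linarith [hz.2]⟩
  have htotal : (Polynomial.nthRootsFinset m (1 : ℂ)).card = m :=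
    (Complex.isPrimitiveRoot_exp m hm.ne').card_nthRootsFinset
  have hsplit : (upperRoots m).card = (strictUpperRoots m).card + 2 := by
    rw [← Finset.card_pair (show (1 : ℂ) ≠ -1 by norm_num [Complex.ext_iff]), ← hreal, upperRoots,
      strictUpperRoots, ← Finset.card_union_of_disjoint, ← Finset.filter_or]
    · congr 1
      ext z
      simp only [Finset.mem_filter, le_iff_lt_or_eq, eq_comm]
    · rw [Finset.disjoint_filter]
      exact fun z _ h h' => h.ne' h'
  have hsum := Finset.card_filter_add_card_filter_not (s := Polynomial.nthRootsFinset m (1 : ℂ))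
    (fun z => 0 ≤ z.im)
  simp only [not_le] at hsum
  rw [hconj, htotal] at hsum
  change (upperRoots m).card + _ = m at hsum
  omega

theorem exists_map_univ_eq {S : Finset ℂ} (s : Sym S n) :
    ∃ z : Fin n → ℂ, Finset.univ.val.map z = (s : Multiset S).map (↑) := by
  obtain ⟨s, hs⟩ := s
  induction s using Quotient.inductionOn with
  | _ L =>
    have hL : L.length = n := hs
    subst hL
    refine ⟨fun i => (L.get i : ℂ), ?_⟩
    rw [Fin.univ_val_map]
    change ((List.ofFn fun i => (L.get i : ℂ) : List ℂ) : Multiset ℂ) = (L : Multiset S).map (↑)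
    rw [Multiset.map_coe]
    congr 1
    conv_rhs => rw [← List.ofFn_get L, List.map_ofFn]
    rfl

theorem exists_sym_of_forall_mem {S : Finset ℂ} {z : Fin n → ℂ} (hz : ∀ i, z i ∈ S) :
    ∃ s : Sym S n, (s : Multiset S).map (↑) = Finset.univ.val.map z :=
  ⟨⟨Finset.univ.val.map fun i => ⟨z i, hz i⟩, by simp⟩, Multiset.map_map _ _ _⟩

theorem mem_of_map_univ_eq {S : Finset ℂ} {s : Sym S n} {z : Fin n → ℂ}
    (h : Finset.univ.val.map z = (s : Multiset S).map (↑)) (i : Fin n) : z i ∈ S := by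
  have : z i ∈ Finset.univ.val.map z := Multiset.mem_map_of_mem z (Finset.mem_univ i)
  rw [h] at this
  obtain ⟨a, -, ha⟩ := Multiset.mem_map.1 this
  exact ha ▸ a.2

/-- Every element of `SO (2 * n)` is orthogonally conjugate to the matrix of rotation blocks of any
listing of its eigenvalues in the closed upper half plane. -/
theorem exists_mul_rotBlocks_eq_of_pow_eq_one {m : ℕ} (hm : 0 < m) {x : SO (2 * n)}
    (hx : x ^ m = 1) :
    ∃ z : Fin n → ℂ, (∀ i, z i ∈ upperRoots m) ∧ ∀ z' : Fin n → ℂ,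
      Finset.univ.val.map z' = Finset.univ.val.map z →
      ∃ g, g * gᵀ = 1 ∧ g * rotBlocks z' = splitMatrix n x * g := by
  obtain ⟨z, g, hz, hg, h⟩ :=
    exists_mul_eq_mul_rotBlocks (splitMatrix_mul_transpose x) (det_splitMatrix x)
  have hg' : gᵀ * g = 1 := mul_eq_one_comm.1 hg
  refine ⟨z, fun i => ?_, fun z' hz' => ?_⟩
  · have hpow : ∀ k : ℕ, splitMatrix n x ^ k * g = g * rotBlocks z ^ k := by
      intro k
      induction k with
      | zero => simp
      | succ k ih => rw [pow_succ', pow_succ, Matrix.mul_assoc, ih, ← Matrix.mul_assoc, h,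
          Matrix.mul_assoc, ← pow_succ', pow_succ]
    have hone : rotBlocks z ^ m = 1 := by
      have := hpow m
      rw [← (splitMatrix n).map_pow, hx, (splitMatrix n).map_one, Matrix.one_mul] at this
      rw [← Matrix.one_mul (rotBlocks z ^ m), ← hg', Matrix.mul_assoc, ← this]
    rw [rotBlocks_pow, ← rotBlocks_one] at hone
    exact (mem_upperRoots hm).2 ⟨congrFun (rotBlocks_injective hone) i, (hz i).2⟩
  · obtain ⟨σ, rfl⟩ := exists_perm_comp_eq hz'
    refine ⟨g.submatrix id (σ.sumCongr σ), ?_, ?_⟩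
    · rw [transpose_submatrix, submatrix_mul_equiv, hg, submatrix_id_id]
    · rw [rotBlocks_comp, submatrix_mul_equiv, ← h]
      rfl

theorem det_eq_one_or_neg_one_of_mul_transpose {ι : Type*} [Fintype ι] [DecidableEq ι]
    {g : Matrix ι ι ℝ} (hg : g * gᵀ = 1) : g.det = 1 ∨ g.det = -1 := by
  have h := congrArg det hg
  rw [det_mul, det_transpose, det_one] at h
  exact mul_self_eq_one_iff.1 h

theorem mul_blockReflection_mul_transpose {g : Matrix (Fin n ⊕ Fin n) (Fin n ⊕ Fin n) ℝ}
    (hg : g * gᵀ = 1) (i : Fin n) :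
    (g * blockReflection i) * (g * blockReflection i)ᵀ = 1 := by
  rw [transpose_mul, blockReflection_transpose, Matrix.mul_assoc, ← Matrix.mul_assoc _ _ gᵀ,
    blockReflection_mul_self, Matrix.one_mul, hg]

theorem blockReflection_mul_mul_transpose {g : Matrix (Fin n ⊕ Fin n) (Fin n ⊕ Fin n) ℝ}
    (hg : g * gᵀ = 1) (i : Fin n) :
    (blockReflection i * g) * (blockReflection i * g)ᵀ = 1 := by
  rw [transpose_mul, blockReflection_transpose, Matrix.mul_assoc, ← Matrix.mul_assoc g,
    hg, Matrix.one_mul, blockReflection_mul_self]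

/-- The conjugacy classes of `SO (2 * n)` of exponent dividing `m` correspond to multisets of
`m`-th roots of unity in the closed upper half plane, those avoiding `±1` counting twice. -/
theorem ncard_conjClasses_eq_card_sym {m : ℕ} (hn : 0 < n) (hm : 0 < m) :
    {c : ConjClasses (SO (2 * n)) | ∀ x ∈ c.carrier, x ^ m = 1}.ncard =
      Nat.card (Sym (upperRoots m) n ⊕ Sym (strictUpperRoots m) n) := by
  let i₀ : Fin n := ⟨0, hn⟩
  set D := blockReflection i₀ with hD
  have hDD : D * D = 1 := blockReflection_mul_self i₀
  choose a ha using fun s : Sym (upperRoots m) n => exists_map_univ_eq s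
  choose b hb using fun t : Sym (strictUpperRoots m) n => exists_map_univ_eq t
  have haU : ∀ s i, a s i ∈ upperRoots m := fun s => mem_of_map_univ_eq (ha s)
  have hbS : ∀ t i, b t i ∈ strictUpperRoots m := fun t => mem_of_map_univ_eq (hb t)
  have hbU : ∀ t i, b t i ∈ upperRoots m := fun t i => strictUpperRoots_subset m (hbS t i)
  have hnorm := fun {z} => norm_eq_one_of_mem_upperRoots hm (z := z)
  choose x hx using fun s => exists_splitMatrix_eq
    (rotBlocks_mul_transpose fun i => (hnorm (haU s i)).1)
    (det_rotBlocks fun i => (hnorm (haU s i)).1)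
  have hconj : ∀ t, ∃ y, splitMatrix n y = D * rotBlocks (b t) * D := by
    intro t
    have hR := rotBlocks_mul_transpose fun i => (hnorm (hbU t i)).1
    refine exists_splitMatrix_eq (mul_blockReflection_mul_transpose
      (blockReflection_mul_mul_transpose hR i₀) i₀) ?_
    rw [det_mul, det_mul, det_rotBlocks fun i => (hnorm (hbU t i)).1, hD, det_blockReflection]
    norm_num
  choose y hy using hconj
  have hpow : ∀ {z : Fin n → ℂ}, (∀ i, z i ∈ upperRoots m) → rotBlocks z ^ m = 1 := by
    intro z hz
    rw [rotBlocks_pow, ← rotBlocks_one]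
    congr 1
    ext i
    exact ((mem_upperRoots hm).1 (hz i)).1
  have hclass : ∀ g : SO (2 * n), (∀ h ∈ (ConjClasses.mk g).carrier, h ^ m = 1) ↔ g ^ m = 1 := by
    refine fun g => ⟨fun h => h g ConjClasses.mem_carrier_mk, fun hg h hh => ?_⟩
    rw [ConjClasses.mem_carrier_iff_mk_eq, ConjClasses.mk_eq_mk_iff_isConj] at hh
    obtain ⟨c, hc⟩ := isConj_iff.1 hh.symm
    rw [← hc, conj_pow, hg, mul_one, mul_inv_cancel]
  have hsymU : ∀ {s s' : Sym (upperRoots m) n},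
      Finset.univ.val.map (a s) = Finset.univ.val.map (a s') → s = s' := by
    intro s s' h
    rw [ha, ha] at h
    exact Subtype.ext (Multiset.map_injective Subtype.val_injective h)
  have hsymS : ∀ {t t' : Sym (strictUpperRoots m) n},
      Finset.univ.val.map (b t) = Finset.univ.val.map (b t') → t = t' := by
    intro s s' h
    rw [hb, hb] at h
    exact Subtype.ext (Multiset.map_injective Subtype.val_injective h)
  let Ψ : Sym (upperRoots m) n ⊕ Sym (strictUpperRoots m) n → ConjClasses (SO (2 * n)) :=
    Sum.elim (fun s => ConjClasses.mk (x s)) fun t => ConjClasses.mk (y t)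
  have hmixed : ∀ s t, ¬ IsConj (x s) (y t) := by
    intro s t h
    obtain ⟨g, hg, hdet, h⟩ := isConj_iff_splitMatrix.1 h
    rw [hx, hy] at h
    have h' : D * g * rotBlocks (a s) = rotBlocks (b t) * (D * g) := by
      rw [Matrix.mul_assoc, h]
      simp only [← Matrix.mul_assoc]
      rw [hDD, Matrix.one_mul]
    have hDg := blockReflection_mul_mul_transpose hg i₀
    have hmap := map_eq_of_mul_rotBlocks (fun i => hnorm (haU s i)) (fun i => hnorm (hbU t i))
      hDg h'
    rw [hb] at hmap
    have := det_eq_one_of_mul_rotBlocks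
      (fun i => ((mem_strictUpperRoots hm).1 (mem_of_map_univ_eq hmap i)).2)
      (fun i => ((mem_strictUpperRoots hm).1 (hbS t i)).2) hDg h'
    rw [det_mul, hdet, det_blockReflection] at this
    norm_num at this
  have hinj : Function.Injective Ψ := by
    rintro (s | t) (s' | t') h <;>
      simp only [Ψ, Sum.elim_inl, Sum.elim_inr, ConjClasses.mk_eq_mk_iff_isConj] at h
    · obtain ⟨g, hg, -, h⟩ := isConj_iff_splitMatrix.1 h
      rw [hx, hx] at h
      rw [hsymU (map_eq_of_mul_rotBlocks (fun i => hnorm (haU s i)) (fun i => hnorm (haU s' i))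
        hg h)]
    · exact (hmixed _ _ h).elim
    · exact (hmixed _ _ h.symm).elim
    · obtain ⟨g, hg, -, h⟩ := isConj_iff_splitMatrix.1 h
      rw [hy, hy] at h
      have h' : D * g * D * rotBlocks (b t) = rotBlocks (b t') * (D * g * D) := by
        have := congrArg (fun M => D * M * D) h
        simp only [← Matrix.mul_assoc, hDD, Matrix.one_mul] at this ⊢
        rwa [Matrix.mul_assoc _ D D, hDD, Matrix.mul_one] at this
      rw [hsymS (map_eq_of_mul_rotBlocks (fun i => hnorm (hbU t i)) (fun i => hnorm (hbU t' i))
        (mul_blockReflection_mul_transpose (blockReflection_mul_mul_transpose hg i₀) i₀) h')]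
  have hrange : {c : ConjClasses (SO (2 * n)) | ∀ x ∈ c.carrier, x ^ m = 1} = Set.range Ψ := by
    ext c
    rw [Set.mem_ofPred_eq]
    constructor
    · induction c using Quotient.inductionOn with
      | _ g =>
      intro hg
      obtain ⟨z, hz, hzg⟩ := exists_mul_rotBlocks_eq_of_pow_eq_one hm ((hclass g).1 hg)
      obtain ⟨s, hs⟩ := exists_sym_of_forall_mem hz
      obtain ⟨h, hh, hhg⟩ := hzg (a s) ((ha s).trans hs)
      rw [← hx] at hhg
      rcases det_eq_one_or_neg_one_of_mul_transpose hh with hdet | hdet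
      · exact ⟨.inl s, ConjClasses.mk_eq_mk_iff_isConj.2
          (isConj_iff_splitMatrix.2 ⟨h, hh, hdet, hhg⟩)⟩
      · by_cases hreal : ∃ i, (a s i).im = 0
        · obtain ⟨i, hi⟩ := hreal
          refine ⟨.inl s, ConjClasses.mk_eq_mk_iff_isConj.2 (isConj_iff_splitMatrix.2
            ⟨h * blockReflection i, mul_blockReflection_mul_transpose hh i, ?_, ?_⟩)⟩
          · rw [det_mul, hdet, det_blockReflection]
            norm_num
          · rw [hx, Matrix.mul_assoc, blockReflection_mul_rotBlocks hi, ← Matrix.mul_assoc,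
              ← hx, hhg, Matrix.mul_assoc]
        · push Not at hreal
          have hstrict : ∀ i, a s i ∈ strictUpperRoots m := fun i =>
            (mem_strictUpperRoots hm).2 ⟨((mem_upperRoots hm).1 (haU s i)).1,
              lt_of_le_of_ne ((mem_upperRoots hm).1 (haU s i)).2 (hreal i).symm⟩
          obtain ⟨t, ht⟩ := exists_sym_of_forall_mem hstrict
          obtain ⟨k, hk, hkg⟩ := hzg (b t) ((hb t).trans (ht.trans ((ha s).trans hs)))
          rcases det_eq_one_or_neg_one_of_mul_transpose hk with hdet' | hdet'
          · have hh' : hᵀ * h = 1 := mul_eq_one_comm.1 hh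
            have horth : hᵀ * k * (hᵀ * k)ᵀ = 1 := by
              rw [transpose_mul, transpose_transpose, Matrix.mul_assoc, ← Matrix.mul_assoc k, hk,
                Matrix.one_mul, hh']
            have hswap : hᵀ * splitMatrix n g = rotBlocks (a s) * hᵀ := by
              calc hᵀ * splitMatrix n g = hᵀ * (splitMatrix n g * h) * hᵀ := by
                    rw [Matrix.mul_assoc, Matrix.mul_assoc, hh, Matrix.mul_one]
                _ = _ := by rw [← hhg, ← Matrix.mul_assoc, hh', Matrix.one_mul, hx]
            have hone := det_eq_one_of_mul_rotBlocks
              (fun i => ((mem_strictUpperRoots hm).1 (hbS t i)).2)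
              (fun i => ((mem_strictUpperRoots hm).1 (hstrict i)).2) horth
              (by rw [Matrix.mul_assoc, hkg, ← Matrix.mul_assoc, hswap, Matrix.mul_assoc])
            rw [det_mul, det_transpose, hdet, hdet'] at hone
            norm_num at hone
          · refine ⟨.inr t, ConjClasses.mk_eq_mk_iff_isConj.2 (isConj_iff_splitMatrix.2
              ⟨k * D, mul_blockReflection_mul_transpose hk i₀, ?_, ?_⟩)⟩
            · rw [det_mul, hdet', hD, det_blockReflection]
              norm_num
            · rw [hy]
              simp only [← Matrix.mul_assoc]
              rw [Matrix.mul_assoc k D D, hDD, Matrix.mul_one, hkg]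
    · rintro ⟨s | t, rfl⟩
      · refine (hclass _).2 (splitMatrix_injective ?_)
        rw [(splitMatrix n).map_pow, (splitMatrix n).map_one, hx, hpow (haU s)]
      · refine (hclass _).2 (splitMatrix_injective ?_)
        rw [(splitMatrix n).map_pow, (splitMatrix n).map_one, hy]
        have : ∀ k : ℕ, (D * rotBlocks (b t) * D) ^ k = D * rotBlocks (b t) ^ k * D := by
          intro k
          induction k with
          | zero => simp [hDD]
          | succ k ih =>
            rw [pow_succ, ih, pow_succ]
            simp only [← Matrix.mul_assoc]
            rw [Matrix.mul_assoc _ D D, hDD, Matrix.mul_one]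
        rw [this, hpow (hbU t), Matrix.mul_one, hDD]
  rw [hrange, Set.ncard_range_of_injective hinj]

end

/-- For any positive integer `n` and even positive integer `m`, the number of conjugacy
classes of `SO(2n)` consisting of elements `x` with `x ^ m = 1` equals
`C(n + m/2, m/2) + C(n + m/2 - 2, n)`. -/
theorem stmt_19 (n m : ℕ) (hn : 0 < n) (hm : 0 < m) (heven : Even m) :
    {c : ConjClasses (SO (2 * n)) | ∀ x ∈ c.carrier, x ^ m = 1}.ncard
      = Nat.choose (n + m / 2) (m / 2) + Nat.choose (n + m / 2 - 2) n := by
  obtain ⟨h1, h2⟩ := card_upperRoots hm heven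
  rw [ncard_conjClasses_eq_card_sym hn hm, Nat.card_eq_fintype_card, Fintype.card_sum,
    Sym.card_sym_eq_choose, Sym.card_sym_eq_choose, Fintype.card_coe, Fintype.card_coe, h1, h2]
  obtain ⟨k, rfl⟩ := heven
  rw [show (k + k) / 2 = k by omega, show k + 1 + n - 1 = n + k by omega,
    show k - 1 + n - 1 = n + k - 2 by omega, Nat.choose_symm_add]
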